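/- Let 0 < α < 1. There exists a constant c > 0, depending only on α, with the following property. Let V be a nontrivial finite-dimensional complex inner product space, A : V → V a self-adjoint positive definite linear operator, τ > 0, and w ∈ V. Define U^0 = 0 and, for n ≥ 1, let U^n ∈ V be the (unique) solution of the backward Euler CQ scheme τ^{-α} Σ_{j=0}^n b_j^{(α)} U^{n-j} + A U^n = f^n, where f^1 = w and f^j = 0 for j ≥ 2. Then for every β ∈ [0,1] and every n ≥ 1, ‖A^β U^n‖ ≤ c · τ · t_n^{(1-β)α - 1} · ‖w‖ and ‖A^β (U^{n+1} - U^n)‖ ≤ c · τ^2 · t_{n+1}^{(1-β)α - 2} · ‖w‖, where t_k = kτ. -/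

import Mathlib

open scoped ComplexInnerProductSpace

/-- The backward Euler convolution quadrature weights `b_j^(α) = (-1)^j binom(α, j)`. -/
noncomputable def cqWeight (α : ℝ) (j : ℕ) : ℝ :=
  (-1 : ℝ) ^ j * (∏ i ∈ Finset.range j, (α - i)) / (Nat.factorial j)

/-- Fractional power `A^β` via the functional (spectral) calculus. -/
noncomputable def opRPow {V : Type} [NormedAddCommGroup V] [InnerProductSpace ℂ V]
    [FiniteDimensional ℂ V] (A : V →L[ℂ] V) (β : ℝ) : V →L[ℂ] V :=
  cfc (fun x : ℝ => x ^ β) A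

theorem cqWeight_zero (α : ℝ) : cqWeight α 0 = 1 := by simp [cqWeight]

theorem cqWeight_succ (α : ℝ) (j : ℕ) :
    cqWeight α (j + 1) = cqWeight α j * ((j - α) / (j + 1)) := by
  have hj : (j : ℝ) + 1 ≠ 0 := by positivity
  have hf : (j.factorial : ℝ) ≠ 0 := by positivity
  simp only [cqWeight, Finset.prod_range_succ, Nat.factorial_succ, pow_succ]
  push_cast
  field_simp
  ring

theorem cqWeight_succ_neg {α : ℝ} (hα0 : 0 < α) (hα1 : α < 1) (j : ℕ) :
    cqWeight α (j + 1) < 0 := by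
  induction j with
  | zero => simp [cqWeight_succ, cqWeight_zero, hα0]
  | succ j ih =>
    rw [cqWeight_succ]
    refine mul_neg_of_neg_of_pos ih (div_pos ?_ (by positivity))
    push_cast
    have : (0 : ℝ) ≤ j := j.cast_nonneg
    linarith

/-- Partial sums of the convolution quadrature weights decay no faster than `n ^ (-α)`. -/
theorem le_sum_cqWeight {α : ℝ} (hα0 : 0 < α) (hα1 : α < 1) (n : ℕ) :
    (1 - α) * ((n : ℝ) + 1) ^ (-α) ≤ ∑ j ∈ Finset.range (n + 1), cqWeight α j := by
  have hsum : ∀ m : ℕ, ∑ j ∈ Finset.range (m + 2), cqWeight α j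
      = (1 - α / (m + 1)) * ∑ j ∈ Finset.range (m + 1), cqWeight α j ∧
      cqWeight α (m + 1) = -(α / (m + 1)) * ∑ j ∈ Finset.range (m + 1), cqWeight α j := by
    intro m
    induction m with
    | zero => simp [Finset.sum_range_succ, cqWeight_succ, cqWeight_zero]; ring
    | succ m ih =>
      have hw : cqWeight α (m + 2)
          = -(α / ((m + 1 : ℕ) + 1)) * ∑ j ∈ Finset.range (m + 2), cqWeight α j := by
        rw [ih.1, cqWeight_succ, ih.2]
        have h1 : (m : ℝ) + 1 ≠ 0 := by positivity
        have h2 : (m : ℝ) + 1 + 1 ≠ 0 := by positivity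
        push_cast
        field_simp
      refine ⟨?_, hw⟩
      rw [Finset.sum_range_succ, hw]
      ring
  have key : ∀ m : ℕ, (1 - α) * ((m : ℝ) + 1) ^ (-α)
      ≤ ∑ j ∈ Finset.range (m + 2), cqWeight α j := by
    intro m
    induction m with
    | zero => simp [(hsum 0).1, cqWeight_zero]
    | succ m ih =>
      rw [(hsum (m + 1)).1]
      have hm : (0 : ℝ) ≤ m := m.cast_nonneg
      have hb : (((m : ℝ) + 1) / (m + 2)) ^ α ≤ 1 - α / (m + 2) := by
        have := rpow_one_add_le_one_add_mul_self (s := -(1 / ((m : ℝ) + 2)))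
          (by rw [neg_le_neg_iff, div_le_one (by positivity)]; linarith) hα0.le hα1.le
        convert this using 1
        · congr 1
          field_simp
          ring
        · ring
      have hs : ((m : ℝ) + 2) ^ (-α)
          = (((m : ℝ) + 1) / (m + 2)) ^ α * ((m : ℝ) + 1) ^ (-α) := by
        rw [Real.div_rpow (by positivity) (by positivity), Real.rpow_neg (by positivity),
          Real.rpow_neg (by positivity)]
        field_simp
      have e1 : (((m + 1 : ℕ) : ℝ) + 1) = m + 2 := by push_cast; ring
      rw [e1, hs]
      calc _ = (((m : ℝ) + 1) / (m + 2)) ^ α * ((1 - α) * ((m : ℝ) + 1) ^ (-α)) := by ring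
        _ ≤ _ := by
          have : 0 ≤ (((m : ℝ) + 1) / (m + 2)) ^ α := by positivity
          have h3 : 0 ≤ (1 - α) * ((m : ℝ) + 1) ^ (-α) :=
            mul_nonneg (by linarith) (by positivity)
          exact mul_le_mul hb ih h3 (this.trans hb)
  cases n with
  | zero => simp [cqWeight_zero, hα0.le]
  | succ n =>
    refine le_trans ?_ (key n)
    have h : (((n + 1 : ℕ) : ℝ) + 1) ^ (-α) ≤ ((n : ℝ) + 1) ^ (-α) :=
      Real.rpow_le_rpow_of_nonpos (by positivity) (by push_cast; linarith) (by linarith)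
    exact mul_le_mul_of_nonneg_left h (by linarith)

/-- The solution of a renewal equation whose kernel `f` is log-convex is log-convex
(de Bruijn and Erdős). -/
theorem renewal_logConvex {f θ v : ℕ → ℝ} (hf : ∀ j, 0 < f j) (hθ : Monotone θ)
    (hfθ : ∀ j, f (j + 1) = θ j * f j) (hv0 : 0 < v 0)
    (hv : ∀ n, v (n + 1) = ∑ j ∈ Finset.range (n + 1), f j * v (n - j)) :
    (∀ n, 0 < v n) ∧ ∀ n, v (n + 1) ^ 2 ≤ v n * v (n + 2) := by
  have hpos : ∀ n, 0 < v n := by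
    intro n
    induction n using Nat.strong_induction_on with
    | _ n ih =>
      cases n with
      | zero => exact hv0
      | succ n =>
        rw [hv]
        exact Finset.sum_pos (fun j hj => mul_pos (hf j) (ih _ (by omega))) (by simp)
  refine ⟨hpos, ?_⟩
  have hv2 : ∀ n, v (n + 2)
      = f 0 * v (n + 1) + ∑ j ∈ Finset.range (n + 1), θ j * f j * v (n - j) := by
    intro n
    rw [hv, Finset.sum_range_succ', add_comm]
    congr 1
    refine Finset.sum_congr rfl fun j _ => ?_
    rw [hfθ, Nat.add_sub_add_right]
  have step : ∀ n, (∀ i ≤ n, v (i + 1) * v n ≤ v i * v (n + 1)) →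
      v (n + 1) ^ 2 ≤ v n * v (n + 2) := by
    intro n ih
    cases n with
    | zero =>
      have h1 : v 1 = f 0 * v 0 := by simpa using hv 0
      have h2 : v 2 = f 0 * v 1 + f 1 * v 0 := by simpa [← hfθ] using hv2 0
      have := mul_pos (hf 1) (mul_pos hv0 hv0)
      simp only [zero_add]
      rw [h2, h1]
      nlinarith
    | succ n =>
      have e1 : v (n + 3) = (f 0 + θ (n + 1)) * v (n + 2)
          - ∑ j ∈ Finset.range (n + 1), (θ (n + 1) - θ j) * f j * v (n + 1 - j) := by
        rw [hv2 (n + 1), hv (n + 1), add_mul, Finset.mul_sum (a := θ (n + 1)),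
          ← hv (n + 1), Finset.sum_range_succ _ (n + 1), Finset.sum_range_succ _ (n + 1)]
        simp only [sub_mul, Finset.sum_sub_distrib, mul_assoc]
        ring
      have e2 : v (n + 2) = (f 0 + θ (n + 1)) * v (n + 1)
          - ∑ j ∈ Finset.range (n + 1), (θ (n + 1) - θ j) * f j * v (n - j) := by
        have h := congrArg (θ (n + 1) * ·) (hv n)
        simp only [Finset.mul_sum] at h
        rw [hv2 n, add_mul, h]
        simp only [sub_mul, Finset.sum_sub_distrib, mul_assoc]
        ring
      have hs : 0 ≤ ∑ j ∈ Finset.range (n + 1), (θ (n + 1) - θ j) * f j *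
          (v (n - j) * v (n + 2) - v (n + 1 - j) * v (n + 1)) := by
        refine Finset.sum_nonneg fun j hj => ?_
        have hj' : j ≤ n := by simpa [Nat.lt_succ_iff] using hj
        refine mul_nonneg (mul_nonneg (sub_nonneg.2 (hθ (by omega))) (hf j).le) ?_
        have := ih (n - j) (by omega)
        rw [← Nat.sub_add_comm hj'] at this
        exact sub_nonneg.2 this
      simp only [mul_sub, Finset.sum_sub_distrib, ← mul_assoc, ← Finset.sum_mul] at hs
      have e1' : ∑ j ∈ Finset.range (n + 1), (θ (n + 1) - θ j) * f j * v (n + 1 - j)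
        = (f 0 + θ (n + 1)) * v (n + 2) - v (n + 3) := by linarith
      have e2' : ∑ j ∈ Finset.range (n + 1), (θ (n + 1) - θ j) * f j * v (n - j)
        = (f 0 + θ (n + 1)) * v (n + 1) - v (n + 2) := by linarith
      rw [e1', e2'] at hs
      change v (n + 2) ^ 2 ≤ v (n + 1) * v (n + 3)
      linarith
  have main : ∀ n, ∀ i ≤ n, v (i + 1) * v n ≤ v i * v (n + 1) := by
    intro n
    induction n with
    | zero => intro i hi; obtain rfl : i = 0 := by omega
              exact (mul_comm _ _).le
    | succ n ih =>
      intro i hi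
      rcases hi.eq_or_lt with rfl | hi
      · exact (mul_comm _ _).le
      · have h1 := ih i (by omega)
        have h2 := step n ih
        refine le_of_mul_le_mul_right ?_ (hpos n)
        calc v (i + 1) * v (n + 1) * v n = v (i + 1) * v n * v (n + 1) := by ring
          _ ≤ v i * v (n + 1) * v (n + 1) := mul_le_mul_of_nonneg_right h1 (hpos _).le
          _ = v i * v (n + 1) ^ 2 := by ring
          _ ≤ v i * (v n * v (n + 2)) := mul_le_mul_of_nonneg_left h2 (hpos _).le
          _ = _ := by ring
  exact fun n => step n (main n)

/-- A convex sequence that is bounded above is antitone. -/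
theorem antitone_of_convex_of_bddAbove {v : ℕ → ℝ} {M : ℝ}
    (hv : ∀ n, 2 * v (n + 1) ≤ v n + v (n + 2)) (hM : ∀ n, v n ≤ M) : Antitone v := by
  refine antitone_nat_of_succ_le fun n => ?_
  by_contra! h
  have hd : ∀ m, v (n + 1) - v n ≤ v (n + m + 1) - v (n + m) := by
    intro m
    induction m with
    | zero => simp
    | succ m ih => have := hv (n + m); simp only [← add_assoc]; linarith
  have hl : ∀ m : ℕ, v n + m * (v (n + 1) - v n) ≤ v (n + m) := by
    intro m
    induction m with
    | zero => simp
    | succ m ih => have := hd m; push_cast; simp only [← add_assoc]; linarith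
  obtain ⟨m, hm⟩ := exists_nat_gt ((M - v n) / (v (n + 1) - v n))
  rw [div_lt_iff₀ (by linarith)] at hm
  have := hl m
  have := hM (n + m)
  linarith

/-- The coefficients of `1 / ((1 - ξ) ^ α + μ)`. -/
noncomputable def cqKernel (α : ℝ) : ℕ → ℝ → ℝ
  | 0, μ => 1 / (1 + μ)
  | n + 1, μ => ∑ j : Fin (n + 1), -cqWeight α (j + 1) / (1 + μ) * cqKernel α (n - j) μ

theorem cqKernel_zero (α μ : ℝ) : cqKernel α 0 μ = 1 / (1 + μ) := by rw [cqKernel]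

theorem cqKernel_succ (α : ℝ) (n : ℕ) (μ : ℝ) : cqKernel α (n + 1) μ
    = ∑ j ∈ Finset.range (n + 1), -cqWeight α (j + 1) / (1 + μ) * cqKernel α (n - j) μ := by
  rw [cqKernel,
    Finset.sum_range fun j => -cqWeight α (j + 1) / (1 + μ) * cqKernel α (n - j) μ]

theorem cqKernel_scheme (α : ℝ) {μ : ℝ} (hμ : 0 < μ) (n : ℕ) :
    ∑ j ∈ Finset.range (n + 1), cqWeight α j * cqKernel α (n - j) μ + μ * cqKernel α n μ
      = if n = 0 then 1 else 0 := by
  have hμ' : 1 + μ ≠ 0 := by positivity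
  cases n with
  | zero => simp [cqWeight_zero, cqKernel_zero]; field_simp
  | succ n =>
    have h : (1 + μ) * cqKernel α (n + 1) μ
        = -∑ j ∈ Finset.range (n + 1), cqWeight α (j + 1) * cqKernel α (n - j) μ := by
      rw [cqKernel_succ, Finset.mul_sum, ← Finset.sum_neg_distrib]
      refine Finset.sum_congr rfl fun j _ => ?_
      field_simp
    rw [Finset.sum_range_succ']
    simp only [Nat.add_sub_add_right, cqWeight_zero, Nat.sub_zero, Nat.add_eq_zero_iff, one_ne_zero,
      and_false, if_false]
    linarith

theorem continuousOn_cqKernel (α : ℝ) (n : ℕ) : ContinuousOn (cqKernel α n) (Set.Ioi 0) := by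
  have hc : ContinuousOn (fun μ : ℝ => 1 + μ) (Set.Ioi 0) := by fun_prop
  have h0 : ∀ μ ∈ Set.Ioi (0 : ℝ), 1 + μ ≠ 0 := fun μ hμ => by
    have : 0 < μ := hμ
    positivity
  induction n using Nat.strong_induction_on with
  | _ n ih =>
    cases n with
    | zero =>
      rw [funext (cqKernel_zero α)]
      exact continuousOn_const.div hc h0
    | succ n =>
      rw [funext (cqKernel_succ α n)]
      exact continuousOn_finsetSum _ fun j _ =>
        (continuousOn_const.div hc h0).mul (ih _ (by omega))

theorem cqKernel_logConvex {α μ : ℝ} (hα0 : 0 < α) (hα1 : α < 1) (hμ : 0 < μ) :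
    (∀ n, 0 < cqKernel α n μ) ∧
      ∀ n, cqKernel α (n + 1) μ ^ 2 ≤ cqKernel α n μ * cqKernel α (n + 2) μ := by
  refine renewal_logConvex (f := fun j => -cqWeight α (j + 1) / (1 + μ))
    (θ := fun j : ℕ => 1 - (1 + α) / (j + 2)) (v := fun n => cqKernel α n μ)
    (fun j => div_pos (neg_pos.2 (cqWeight_succ_neg hα0 hα1 j)) (by positivity)) ?_ ?_ ?_
    (fun n => cqKernel_succ α n μ)
  · intro i j hij
    have : (i : ℝ) ≤ j := by exact_mod_cast hij
    dsimp only
    gcongr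
  · intro j
    have : (j : ℝ) + 2 ≠ 0 := by positivity
    have : (j : ℝ) + 1 + 1 ≠ 0 := by positivity
    rw [cqWeight_succ α (j + 1)]
    push_cast
    field_simp
    ring
  · rw [cqKernel_zero]; positivity

theorem sum_cqKernel_le {α μ : ℝ} (hα0 : 0 < α) (hα1 : α < 1) (hμ : 0 < μ) (n : ℕ) :
    μ * ∑ k ∈ Finset.range (n + 1), cqKernel α k μ ≤ 1 ∧
      ∑ k ∈ Finset.range (n + 1), cqKernel α k μ ≤ ((n : ℝ) + 1) ^ α / (1 - α) := by
  have hpos := (cqKernel_logConvex hα0 hα1 hμ).1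
  set S : ℕ → ℝ := fun n => ∑ k ∈ Finset.range (n + 1), cqKernel α k μ with hS
  have hSpos : ∀ n, 0 < S n := fun n => Finset.sum_pos (fun k _ => hpos k) (by simp)
  have hSmono : Monotone S := monotone_nat_of_le_succ fun n => by
    simp only [hS]
    rw [Finset.sum_range_succ _ (n + 1)]
    exact le_add_of_nonneg_right (hpos _).le
  have hsum : ∀ n, ∑ j ∈ Finset.range (n + 1), cqWeight α j * S (n - j) + μ * S n = 1 := by
    intro n
    induction n with
    | zero => simpa [hS] using cqKernel_scheme α hμ 0
    | succ n ih =>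
      have h1 := cqKernel_scheme α hμ (n + 1)
      simp only [Nat.add_eq_zero_iff, one_ne_zero, and_false, if_false] at h1
      have hSs : ∀ m, S (m + 1) = S m + cqKernel α (m + 1) μ := fun m =>
        Finset.sum_range_succ _ _
      have h2 : ∑ j ∈ Finset.range (n + 1 + 1), cqWeight α j * S (n + 1 - j)
          = ∑ j ∈ Finset.range (n + 1), cqWeight α j * S (n - j)
            + ∑ j ∈ Finset.range (n + 1 + 1), cqWeight α j * cqKernel α (n + 1 - j) μ := by
        rw [Finset.sum_range_succ, Finset.sum_range_succ _ (n + 1), ← add_assoc,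
          ← Finset.sum_add_distrib]
        congr 1
        · refine Finset.sum_congr rfl fun j hj => ?_
          have hj' : j ≤ n := by simpa [Nat.lt_succ_iff] using hj
          rw [Nat.sub_add_comm hj', hSs, mul_add]
        · simp [hS]
      rw [h2, hSs]
      linarith
  have hle : (∑ j ∈ Finset.range (n + 1), cqWeight α j) * S n
      ≤ ∑ j ∈ Finset.range (n + 1), cqWeight α j * S (n - j) := by
    rw [Finset.sum_mul]
    refine Finset.sum_le_sum fun j _ => ?_
    cases j with
    | zero => simp
    | succ j =>
      exact mul_le_mul_of_nonpos_left (hSmono (Nat.sub_le _ _)) (cqWeight_succ_neg hα0 hα1 j).le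
  have hB := le_sum_cqWeight hα0 hα1 n
  have h1α : 0 < 1 - α := by linarith
  have hBpos : 0 < (1 - α) * ((n : ℝ) + 1) ^ (-α) := by positivity
  have hBS : (1 - α) * ((n : ℝ) + 1) ^ (-α) * S n
      ≤ (∑ j ∈ Finset.range (n + 1), cqWeight α j) * S n :=
    mul_le_mul_of_nonneg_right hB (hSpos n).le
  have hBS0 : 0 < (1 - α) * ((n : ℝ) + 1) ^ (-α) * S n := mul_pos hBpos (hSpos n)
  have hn := hsum n
  have hμS := mul_pos hμ (hSpos n)
  refine ⟨by change μ * S n ≤ 1; linarith, ?_⟩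
  change S n ≤ _
  rw [le_div_iff₀ h1α]
  have h1 : (1 - α) * ((n : ℝ) + 1) ^ (-α) * S n ≤ 1 := by linarith
  rw [Real.rpow_neg (by positivity)] at h1
  have hp : 0 < ((n : ℝ) + 1) ^ α := by positivity
  field_simp at h1
  linarith

theorem antitone_cqKernel {α μ : ℝ} (hα0 : 0 < α) (hα1 : α < 1) (hμ : 0 < μ) :
    Antitone (fun n => cqKernel α n μ) ∧ ∀ n,
      2 * cqKernel α (n + 1) μ ≤ cqKernel α n μ + cqKernel α (n + 2) μ := by
  obtain ⟨hpos, hlog⟩ := cqKernel_logConvex hα0 hα1 hμ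
  have hconv : ∀ n, 2 * cqKernel α (n + 1) μ ≤ cqKernel α n μ + cqKernel α (n + 2) μ := by
    intro n
    refine abs_le_of_sq_le_sq' ?_ (add_pos (hpos _) (hpos _)).le |>.2
    nlinarith [hlog n, sq_nonneg (cqKernel α n μ - cqKernel α (n + 2) μ)]
  refine ⟨antitone_of_convex_of_bddAbove (M := 1 / μ) hconv fun n => ?_, hconv⟩
  rw [le_div_iff₀ hμ]
  have h1 := (sum_cqKernel_le hα0 hα1 hμ n).1
  have h2 : cqKernel α n μ ≤ ∑ k ∈ Finset.range (n + 1), cqKernel α k μ :=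
    Finset.single_le_sum (f := fun k => cqKernel α k μ) (fun k _ => (hpos k).le) (by simp)
  nlinarith

theorem rpow_mul_sum_cqKernel_le {α μ β : ℝ} (hα0 : 0 < α) (hα1 : α < 1) (hμ : 0 < μ)
    (hβ0 : 0 ≤ β) (hβ1 : β ≤ 1) (n : ℕ) :
    μ ^ β * ∑ k ∈ Finset.range (n + 1), cqKernel α k μ
      ≤ ((n : ℝ) + 1) ^ ((1 - β) * α) / (1 - α) := by
  obtain ⟨h1, h2⟩ := sum_cqKernel_le hα0 hα1 hμ n
  have hpos := (cqKernel_logConvex hα0 hα1 hμ).1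
  have hS : 0 < ∑ k ∈ Finset.range (n + 1), cqKernel α k μ :=
    Finset.sum_pos (fun k _ => hpos k) (by simp)
  set S := ∑ k ∈ Finset.range (n + 1), cqKernel α k μ
  have h1α : 0 < 1 - α := by linarith
  have e : μ ^ β * S = (μ * S) ^ β * S ^ (1 - β) := by
    rw [Real.mul_rpow hμ.le hS.le, mul_assoc, ← Real.rpow_add hS]
    simp
  rw [e]
  calc (μ * S) ^ β * S ^ (1 - β)
      ≤ 1 * (((n : ℝ) + 1) ^ α / (1 - α)) ^ (1 - β) := by
        gcongr
        · exact Real.rpow_le_one (by positivity) h1 hβ0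
    _ = ((n : ℝ) + 1) ^ ((1 - β) * α) / (1 - α) ^ (1 - β) := by
        rw [one_mul, Real.div_rpow (by positivity) h1α.le, ← Real.rpow_mul (by positivity),
          mul_comm α]
    _ ≤ _ := by
        gcongr
        conv_lhs => rw [← Real.rpow_one (1 - α)]
        exact Real.rpow_le_rpow_of_exponent_ge h1α (by linarith) (by linarith)

theorem rpow_mul_cqKernel_le {α μ β : ℝ} (hα0 : 0 < α) (hα1 : α < 1) (hμ : 0 < μ)
    (hβ0 : 0 ≤ β) (hβ1 : β ≤ 1) (n : ℕ) :
    |μ ^ β * cqKernel α n μ| ≤ 4 / (1 - α) * ((n : ℝ) + 1) ^ ((1 - β) * α - 1) := by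
  have hS := rpow_mul_sum_cqKernel_le hα0 hα1 hμ hβ0 hβ1 n
  have hpos := (cqKernel_logConvex hα0 hα1 hμ).1
  have hanti := (antitone_cqKernel hα0 hα1 hμ).1
  have h1α : 0 < 1 - α := by linarith
  have h : ((n : ℝ) + 1) * cqKernel α n μ ≤ ∑ k ∈ Finset.range (n + 1), cqKernel α k μ := by
    have := Finset.card_nsmul_le_sum (Finset.range (n + 1)) (fun k => cqKernel α k μ)
      (cqKernel α n μ) (fun k hk => hanti (by simpa [Nat.lt_succ_iff] using hk))
    simpa using this
  have hμβ : 0 < μ ^ β := by positivity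
  rw [abs_of_nonneg (mul_nonneg hμβ.le (hpos n).le), Real.rpow_sub_one (by positivity)]
  have hX : 0 ≤ ((n : ℝ) + 1) ^ ((1 - β) * α) / (1 - α) := by positivity
  have : μ ^ β * (((n : ℝ) + 1) * cqKernel α n μ)
      ≤ 4 * (((n : ℝ) + 1) ^ ((1 - β) * α) / (1 - α)) :=
    (mul_le_mul_of_nonneg_left h hμβ.le).trans (by linarith)
  calc μ ^ β * cqKernel α n μ = μ ^ β * (((n : ℝ) + 1) * cqKernel α n μ) / (n + 1) := by
        field_simp
    _ ≤ 4 * (((n : ℝ) + 1) ^ ((1 - β) * α) / (1 - α)) / (n + 1) := by gcongr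
    _ = _ := by ring

theorem rpow_mul_cqKernel_sub_le {α μ β : ℝ} (hα0 : 0 < α) (hα1 : α < 1) (hμ : 0 < μ)
    (hβ0 : 0 ≤ β) (hβ1 : β ≤ 1) (n : ℕ) :
    |μ ^ β * (cqKernel α (n + 1) μ - cqKernel α n μ)|
      ≤ 4 / (1 - α) * ((n : ℝ) + 2) ^ ((1 - β) * α - 2) := by
  have hS := rpow_mul_sum_cqKernel_le hα0 hα1 hμ hβ0 hβ1 n
  have hpos := (cqKernel_logConvex hα0 hα1 hμ).1
  obtain ⟨hanti, hconv⟩ := antitone_cqKernel hα0 hα1 hμ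
  have h1α : 0 < 1 - α := by linarith
  have hd : 0 ≤ cqKernel α n μ - cqKernel α (n + 1) μ := sub_nonneg.2 (hanti (Nat.le_succ n))
  have h : ((n : ℝ) + 1) * (n + 2) / 2 * (cqKernel α n μ - cqKernel α (n + 1) μ)
      ≤ ∑ k ∈ Finset.range (n + 1), cqKernel α k μ := by
    have h' : ((n : ℝ) + 1) * (n + 2) / 2 * (cqKernel α n μ - cqKernel α (n + 1) μ)
        + (n + 1) * cqKernel α (n + 1) μ ≤ ∑ k ∈ Finset.range (n + 1), cqKernel α k μ := by
      clear hS hd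
      induction n with
      | zero => simp
      | succ n ih =>
        rw [Finset.sum_range_succ]
        have hc := mul_le_mul_of_nonneg_left (hconv n)
          (show (0 : ℝ) ≤ ((n : ℝ) + 1) * (n + 2) / 2 by positivity)
        push_cast
        simp only [add_assoc, one_add_one_eq_two] at *
        nlinarith
    have := mul_pos (show (0 : ℝ) < n + 1 by positivity) (hpos (n + 1))
    linarith
  have hμβ : 0 < μ ^ β := by positivity
  rw [abs_mul, abs_of_pos hμβ, abs_sub_comm, abs_of_nonneg hd]
  set d := cqKernel α n μ - cqKernel α (n + 1) μ
  have h4 : ((n : ℝ) + 2) ^ 2 * d ≤ 4 * ∑ k ∈ Finset.range (n + 1), cqKernel α k μ := by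
    have : (0 : ℝ) ≤ n := n.cast_nonneg
    have : ((n : ℝ) + 2) ^ 2 * d ≤ 4 * (((n : ℝ) + 1) * (n + 2) / 2 * d) := by
      rw [← mul_assoc]
      gcongr
      nlinarith
    linarith
  have hmono : ((n : ℝ) + 1) ^ ((1 - β) * α) ≤ ((n : ℝ) + 2) ^ ((1 - β) * α) :=
    Real.rpow_le_rpow (by positivity) (by linarith) (mul_nonneg (by linarith) hα0.le)
  have e2 : ((n : ℝ) + 2) ^ ((1 - β) * α - 2)
      = ((n : ℝ) + 2) ^ ((1 - β) * α) / ((n : ℝ) + 2) ^ 2 := by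
    rw [Real.rpow_sub (by positivity)]
    norm_num
  rw [e2]
  calc μ ^ β * d = μ ^ β * (((n : ℝ) + 2) ^ 2 * d) / ((n : ℝ) + 2) ^ 2 := by field_simp
    _ ≤ μ ^ β * (4 * ∑ k ∈ Finset.range (n + 1), cqKernel α k μ) / ((n : ℝ) + 2) ^ 2 := by
        gcongr
    _ = 4 * (μ ^ β * ∑ k ∈ Finset.range (n + 1), cqKernel α k μ) / ((n : ℝ) + 2) ^ 2 := by ring
    _ ≤ 4 * (((n : ℝ) + 2) ^ ((1 - β) * α) / (1 - α)) / ((n : ℝ) + 2) ^ 2 := by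
        have : ((n : ℝ) + 1) ^ ((1 - β) * α) / (1 - α)
          ≤ ((n : ℝ) + 2) ^ ((1 - β) * α) / (1 - α) := by gcongr
        gcongr
        exact hS.trans this
    _ = _ := by ring

section Operator

variable {V : Type} [NormedAddCommGroup V] [InnerProductSpace ℂ V]
  {A : V →L[ℂ] V}

theorem eq_zero_of_smul_add_apply_eq_zero (hA : ∀ x : V, x ≠ 0 → 0 < (⟪A x, x⟫).re)
    {r : ℝ} (hr : 0 ≤ r) {x : V} (hx : r • x + A x = 0) : x = 0 := by
  by_contra hx0
  have h1 := hA x hx0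
  have h2 : A x = -(r • x) := by rw [eq_neg_iff_add_eq_zero, add_comm, hx]
  rw [h2, ← Complex.coe_smul, inner_neg_left, inner_smul_left, inner_self_eq_norm_sq_to_K] at h1
  have h3 : (-((starRingEnd ℂ) (r : ℂ) * ((‖x‖ : ℝ) : ℂ) ^ 2)).re = -(r * ‖x‖ ^ 2) := by
    rw [Complex.conj_ofReal]
    norm_cast
  have h4 : 0 < -(r * ‖x‖ ^ 2) := h3 ▸ h1
  have : 0 ≤ r * ‖x‖ ^ 2 := by positivity
  linarith

variable [FiniteDimensional ℂ V]

theorem spectrum_subset_Ioi (hA : ∀ x : V, x ≠ 0 → 0 < (⟪A x, x⟫).re) :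
    spectrum ℝ A ⊆ Set.Ioi 0 := by
  intro r hr
  by_contra hr0
  rw [Set.mem_Ioi, not_lt] at hr0
  refine hr (spectrum.mem_resolventSet_iff.2 ?_)
  have : CompleteSpace V := FiniteDimensional.complete ℂ V
  rw [ContinuousLinearMap.isUnit_iff_isUnit_toLinearMap, LinearMap.isUnit_iff_ker_eq_bot,
    LinearMap.ker_eq_bot']
  intro x hx
  refine eq_zero_of_smul_add_apply_eq_zero hA (neg_nonneg.2 hr0) (x := x) ?_
  have hx' : r • x - A x = 0 := by
    simpa [Algebra.algebraMap_eq_smul_one] using hx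
  rw [neg_smul, ← neg_eq_zero, ← hx']
  abel

theorem norm_cfc_apply_le {f : ℝ → ℝ} {c : ℝ} (hA : ∀ x : V, x ≠ 0 → 0 < (⟪A x, x⟫).re)
    (hc : 0 ≤ c) (h : ∀ x, 0 < x → |f x| ≤ c) (w : V) : ‖cfc f A w‖ ≤ c * ‖w‖ :=
  (cfc f A).le_of_opNorm_le (norm_cfc_le hc fun x hx => h x (spectrum_subset_Ioi hA hx)) w

/-- The symbol of the solution operator of the scheme with step size `τ`. -/
noncomputable def cqSymbol (α τ : ℝ) (n : ℕ) (x : ℝ) : ℝ :=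
  τ ^ α * cqKernel α n (τ ^ α * x)

theorem continuousOn_cqSymbol (α : ℝ) {τ : ℝ} (hτ : 0 < τ) (n : ℕ) :
    ContinuousOn (cqSymbol α τ n) (Set.Ioi 0) := by
  refine continuousOn_const.mul ((continuousOn_cqKernel α n).comp (by fun_prop) fun x hx => ?_)
  have hx' : (0 : ℝ) < x := hx
  exact mul_pos (by positivity) hx'

theorem cqSymbol_scheme (α : ℝ) {τ x : ℝ} (hτ : 0 < τ) (hx : 0 < x) (n : ℕ) :
    τ ^ (-α) * ∑ j ∈ Finset.range (n + 1), cqWeight α j * cqSymbol α τ (n - j) x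
      + x * cqSymbol α τ n x = if n = 0 then 1 else 0 := by
  rw [← cqKernel_scheme α (mul_pos (Real.rpow_pos_of_pos hτ α) hx) n]
  simp only [cqSymbol, mul_left_comm _ (τ ^ α), ← Finset.mul_sum]
  rw [← mul_assoc, ← Real.rpow_add hτ]
  simp [mul_assoc]

theorem cqScheme_solution (hsa : IsSelfAdjoint A)
    (hA : ∀ x : V, x ≠ 0 → 0 < (⟪A x, x⟫).re) (α : ℝ) {τ : ℝ} (hτ : 0 < τ) (w : V) (U : ℕ → V)
    (hU0 : U 0 = 0)
    (hU : ∀ n : ℕ, 1 ≤ n →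
      τ ^ (-α) • (∑ j ∈ Finset.range (n + 1), cqWeight α j • U (n - j)) + A (U n)
        = if n = 1 then w else 0) (n : ℕ) :
    U (n + 1) = cfc (cqSymbol α τ n) A w := by
  have hspec := spectrum_subset_Ioi hA
  have hcont : ∀ n, ContinuousOn (cqSymbol α τ n) (spectrum ℝ A) := fun n =>
    (continuousOn_cqSymbol α hτ n).mono hspec
  have hop : ∀ n : ℕ, τ ^ (-α) • (∑ j ∈ Finset.range (n + 1),
      cqWeight α j • cfc (cqSymbol α τ (n - j)) A) + A * cfc (cqSymbol α τ n) A
        = if n = 0 then 1 else 0 := by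
    intro n
    have hsumc : ContinuousOn (fun x => ∑ j ∈ Finset.range (n + 1),
        cqWeight α j * cqSymbol α τ (n - j) x) (spectrum ℝ A) :=
      continuousOn_finsetSum _ fun j _ => continuousOn_const.mul (hcont _)
    have h1 : cfc (fun x => ∑ j ∈ Finset.range (n + 1),
        cqWeight α j * cqSymbol α τ (n - j) x) A
        = ∑ j ∈ Finset.range (n + 1), cqWeight α j • cfc (cqSymbol α τ (n - j)) A := by
      have := cfc_sum (fun j x => cqWeight α j * cqSymbol α τ (n - j) x) A
        (Finset.range (n + 1)) fun j _ => continuousOn_const.mul (hcont _)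
      rw [Finset.sum_fn] at this
      rw [this]
      exact Finset.sum_congr rfl fun j _ => cfc_const_mul _ _ _ (hcont _)
    have h2 : cfc (fun x => x * cqSymbol α τ n x) A = A * cfc (cqSymbol α τ n) A := by
      rw [cfc_mul (fun x => x) _ A continuousOn_id (hcont n), cfc_id' ℝ A hsa]
    rw [← h1, ← h2, ← cfc_const_mul _ _ _ hsumc,
      ← cfc_add (a := A) (f := fun x => τ ^ (-α) * ∑ j ∈ Finset.range (n + 1),
          cqWeight α j * cqSymbol α τ (n - j) x) (g := fun x => x * cqSymbol α τ n x)
        (continuousOn_const.mul hsumc) (continuousOn_id.mul (hcont n)),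
      cfc_congr (g := fun _ => if n = 0 then 1 else 0)
        (fun x hx => cqSymbol_scheme α hτ (hspec hx) n), cfc_const _ A hsa]
    split_ifs <;> simp
  induction n using Nat.strong_induction_on with
  | _ n ih =>
    rw [← sub_eq_zero]
    refine eq_zero_of_smul_add_apply_eq_zero hA (Real.rpow_nonneg hτ.le (-α)) ?_
    have h1 := hU (n + 1) (by omega)
    have h2 := congrArg (fun T : V →L[ℂ] V => T w) (hop n)
    rw [Finset.sum_range_succ, Nat.sub_self, hU0, smul_zero, add_zero] at h1
    have h3 : (if n + 1 = 1 then w else 0) = (if n = 0 then (1 : V →L[ℂ] V) else 0) w := by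
      by_cases h : n = 0 <;> simp [h]
    rw [h3, ← h2] at h1
    rw [Finset.sum_range_succ', Finset.sum_range_succ'] at h1
    have h4 : ∑ k ∈ Finset.range n, cqWeight α (k + 1) • U (n + 1 - (k + 1))
        = (∑ k ∈ Finset.range n,
            cqWeight α (k + 1) • cfc (cqSymbol α τ (n - (k + 1))) A) w := by
      rw [sum_apply]
      refine Finset.sum_congr rfl fun k hk => ?_
      have hk' : k < n := Finset.mem_range.1 hk
      rw [smul_apply, ← ih (n - (k + 1)) (by omega)]
      congr 2
      omega
    rw [h4] at h1
    simp only [cqWeight_zero, one_smul, Nat.sub_zero, add_apply,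
      smul_apply, mul_apply_eq_comp, smul_add] at h1
    rw [map_sub, smul_sub]
    rw [add_assoc, add_assoc, add_right_inj, ← sub_eq_zero] at h1
    rw [← h1]
    abel

end Operator

/-- Smoothing properties of the discrete solution operator `E_{h,τ}`:
if `U^0 = 0` and `∂̄_τ^α U^n + A U^n = f^n` with `f^1 = w`, `f^j = 0` for `j ≥ 2`, then
`‖A^β U^n‖ ≤ c τ t_n^{(1-β)α-1} ‖w‖` and `‖A^β (U^{n+1}-U^n)‖ ≤ c τ² t_{n+1}^{(1-β)α-2} ‖w‖`. -/
theorem discrete_solution_operator_smoothing (α : ℝ) (hα0 : 0 < α) (hα1 : α < 1) :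
    ∃ c : ℝ, 0 < c ∧
      ∀ (V : Type) (_ : NormedAddCommGroup V) (_ : InnerProductSpace ℂ V)
        (_ : FiniteDimensional ℂ V) (_ : Nontrivial V)
        (A : V →L[ℂ] V), IsSelfAdjoint A →
        (∀ x : V, x ≠ 0 → 0 < (⟪A x, x⟫).re) →
        ∀ τ : ℝ, 0 < τ → ∀ (w : V) (U : ℕ → V), U 0 = 0 →
        (∀ n : ℕ, 1 ≤ n →
          τ ^ (-α) • (∑ j ∈ Finset.range (n + 1), cqWeight α j • U (n - j)) + A (U n)
            = if n = 1 then w else 0) →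
        ∀ β : ℝ, 0 ≤ β → β ≤ 1 → ∀ n : ℕ, 1 ≤ n →
          ‖opRPow A β (U n)‖ ≤ c * τ * (((n : ℝ) * τ) ^ ((1 - β) * α - 1)) * ‖w‖ ∧
          ‖opRPow A β (U (n + 1) - U n)‖
            ≤ c * τ ^ 2 * ((((n : ℝ) + 1) * τ) ^ ((1 - β) * α - 2)) * ‖w‖ := by
  have h1α : 0 < 1 - α := by linarith
  refine ⟨4 / (1 - α), by positivity, ?_⟩
  intro V _ _ _ _ A hsa hA τ hτ w U hU0 hU β hβ0 hβ1 n hn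
  obtain ⟨n, rfl⟩ := Nat.exists_eq_add_of_le' hn
  have hspec := spectrum_subset_Ioi hA
  have hsol := cqScheme_solution hsa hA α hτ w U hU0 hU
  have hcont : ∀ n, ContinuousOn (cqSymbol α τ n) (spectrum ℝ A) := fun n =>
    (continuousOn_cqSymbol α hτ n).mono hspec
  have hpow : ContinuousOn (fun x : ℝ => x ^ β) (spectrum ℝ A) :=
    (continuousOn_id.rpow_const fun x hx => Or.inl (ne_of_gt hx)).mono hspec
  have hscale : ∀ x : ℝ, 0 < x → ∀ y : ℝ,
      x ^ β * (τ ^ α * y) = τ ^ ((1 - β) * α) * ((τ ^ α * x) ^ β * y) := by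
    intro x hx y
    rw [Real.mul_rpow (by positivity) hx.le, ← Real.rpow_mul hτ.le]
    have : τ ^ α = τ ^ ((1 - β) * α) * τ ^ (α * β) := by
      rw [← Real.rpow_add hτ]
      congr 1
      ring
    rw [this]
    ring
  have hτpos : 0 < τ ^ ((1 - β) * α) := by positivity
  constructor
  · rw [hsol n, opRPow, ← mul_apply_eq_comp, ← cfc_mul _ _ A hpow (hcont n)]
    refine norm_cfc_apply_le hA (by positivity) (fun x hx => ?_) w
    have hb := rpow_mul_cqKernel_le hα0 hα1 (mul_pos (Real.rpow_pos_of_pos hτ α) hx) hβ0 hβ1 n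
    rw [cqSymbol, hscale x hx, abs_mul, abs_of_pos hτpos]
    refine (mul_le_mul_of_nonneg_left hb hτpos.le).trans_eq ?_
    push_cast
    rw [Real.mul_rpow (by positivity) hτ.le, Real.rpow_sub_one hτ.ne']
    field_simp
  · rw [hsol n, hsol (n + 1), ← sub_apply,
      ← cfc_sub _ _ A (hcont (n + 1)) (hcont n), opRPow, ← mul_apply_eq_comp,
      ← cfc_mul _ (fun x => cqSymbol α τ (n + 1) x - cqSymbol α τ n x) A hpow
        ((hcont (n + 1)).sub (hcont n))]
    refine norm_cfc_apply_le hA (by positivity) (fun x hx => ?_) w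
    have hb := rpow_mul_cqKernel_sub_le hα0 hα1 (mul_pos (Real.rpow_pos_of_pos hτ α) hx)
      hβ0 hβ1 n
    rw [cqSymbol, cqSymbol, ← mul_sub, hscale x hx, abs_mul, abs_of_pos hτpos]
    refine (mul_le_mul_of_nonneg_left hb hτpos.le).trans_eq ?_
    have e : ((n + 1 : ℕ) : ℝ) + 1 = n + 2 := by
      push_cast
      ring
    rw [e, Real.mul_rpow (by positivity) hτ.le, Real.rpow_sub hτ _ 2, Real.rpow_two]
    field_simp
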